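/- For every modulus p ∈ [0,1), the Jacobi elliptic functions of modulus p satisfy sn(K(p)) = 1, cn(K(p)) = 0 and dn(K(p)) = √(1−p²), where K(p) is the complete elliptic integral of the first kind. -/

import Mathlib

/-- The complete elliptic integral of the first kind,
`K(p) = ∫₀^{π/2} dθ/√(1 − p² sin²θ)`. -/
noncomputable def ellipticK (p : ℝ) : ℝ :=
  ∫ θ in (0:ℝ)..(Real.pi / 2), 1 / Real.sqrt (1 - p ^ 2 * Real.sin θ ^ 2)

/-- `sn`, `cn`, `dn` are the Jacobi elliptic functions of modulus `p`: the (unique) global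
solution of the system `sn' = cn·dn`, `cn' = −sn·dn`, `dn' = −p²·sn·cn` with
`sn 0 = 0`, `cn 0 = 1`, `dn 0 = 1`. -/
structure IsJacobiSystem (p : ℝ) (sn cn dn : ℝ → ℝ) : Prop where
  sn_zero : sn 0 = 0
  cn_zero : cn 0 = 1
  dn_zero : dn 0 = 1
  hasDerivAt_sn : ∀ x : ℝ, HasDerivAt sn (cn x * dn x) x
  hasDerivAt_cn : ∀ x : ℝ, HasDerivAt cn (-(sn x * dn x)) x
  hasDerivAt_dn : ∀ x : ℝ, HasDerivAt dn (-(p ^ 2 * sn x * cn x)) x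

/-- A real function with vanishing derivative takes the same value everywhere. -/
lemma eq_of_forall_hasDerivAt_zero {f : ℝ → ℝ} (hf : ∀ x, HasDerivAt f 0 x) (x y : ℝ) :
    f x = f y :=
  is_const_of_deriv_eq_zero (fun x => (hf x).differentiableAt) (fun x => (hf x).deriv) x y

lemma one_sub_sq_mul_sin_sq_pos {p : ℝ} (hp : p ^ 2 < 1) (θ : ℝ) :
    0 < 1 - p ^ 2 * Real.sin θ ^ 2 := by
  nlinarith [Real.sin_sq_le_one θ, sq_nonneg p, sq_nonneg (Real.sin θ)]

/-- The incomplete elliptic integral of the first kind. -/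
noncomputable def ellipticF (p φ : ℝ) : ℝ :=
  ∫ θ in (0:ℝ)..φ, 1 / Real.sqrt (1 - p ^ 2 * Real.sin θ ^ 2)

lemma hasDerivAt_ellipticF {p : ℝ} (hp : p ^ 2 < 1) (φ : ℝ) :
    HasDerivAt (ellipticF p) (1 / Real.sqrt (1 - p ^ 2 * Real.sin φ ^ 2)) φ := by
  have hc : Continuous fun θ : ℝ => 1 / Real.sqrt (1 - p ^ 2 * Real.sin θ ^ 2) :=
    continuous_const.div (by fun_prop)
      fun θ => (Real.sqrt_pos.2 (one_sub_sq_mul_sin_sq_pos hp θ)).ne'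
  exact hc.integral_hasStrictDerivAt 0 φ |>.hasDerivAt

lemma strictMono_ellipticF {p : ℝ} (hp : p ^ 2 < 1) : StrictMono (ellipticF p) :=
  strictMono_of_deriv_pos fun φ => by
    rw [(hasDerivAt_ellipticF hp φ).deriv]
    exact one_div_pos.2 (Real.sqrt_pos.2 (one_sub_sq_mul_sin_sq_pos hp φ))

namespace IsJacobiSystem

variable {p : ℝ} {sn cn dn : ℝ → ℝ}

lemma continuous_dn (hJ : IsJacobiSystem p sn cn dn) : Continuous dn :=
  continuous_iff_continuousAt.2 fun x => (hJ.hasDerivAt_dn x).continuousAt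

lemma sn_sq_add_cn_sq (hJ : IsJacobiSystem p sn cn dn) (x : ℝ) : sn x ^ 2 + cn x ^ 2 = 1 := by
  have h := eq_of_forall_hasDerivAt_zero (f := fun x => sn x ^ 2 + cn x ^ 2) (fun x => by
    refine (((hJ.hasDerivAt_sn x).fun_pow 2).fun_add
      ((hJ.hasDerivAt_cn x).fun_pow 2)).congr_deriv ?_
    ring) x 0
  simpa [hJ.sn_zero, hJ.cn_zero] using h

lemma dn_sq (hJ : IsJacobiSystem p sn cn dn) (x : ℝ) : dn x ^ 2 = 1 - p ^ 2 * sn x ^ 2 := by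
  have h := eq_of_forall_hasDerivAt_zero (f := fun x => dn x ^ 2 + p ^ 2 * sn x ^ 2) (fun x => by
    refine (((hJ.hasDerivAt_dn x).fun_pow 2).fun_add
      (((hJ.hasDerivAt_sn x).fun_pow 2).const_mul (p ^ 2))).congr_deriv ?_
    ring) x 0
  simp only [hJ.sn_zero, hJ.dn_zero] at h
  linarith

lemma dn_pos (hJ : IsJacobiSystem p sn cn dn) (hp : p ^ 2 < 1) (x : ℝ) : 0 < dn x := by
  by_contra! hx
  obtain ⟨y, hy⟩ := mem_range_of_exists_le_of_exists_ge hJ.continuous_dn ⟨x, hx⟩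
    ⟨0, by simp [hJ.dn_zero]⟩
  have h := hJ.dn_sq y
  rw [hy] at h
  nlinarith [hJ.sn_sq_add_cn_sq y, sq_nonneg (sn y), sq_nonneg (cn y), sq_nonneg p]

lemma dn_eq_sqrt (hJ : IsJacobiSystem p sn cn dn) (hp : p ^ 2 < 1) (x : ℝ) :
    dn x = Real.sqrt (1 - p ^ 2 * sn x ^ 2) := by
  rw [← hJ.dn_sq, Real.sqrt_sq (hJ.dn_pos hp x).le]

/-- The Jacobi amplitude, the primitive of `dn` vanishing at `0`, is an angle parametrizing
the point `(cn, sn)` of the unit circle. -/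
lemma exists_amplitude (hJ : IsJacobiSystem p sn cn dn) :
    ∃ am : ℝ → ℝ, am 0 = 0 ∧ (∀ x, HasDerivAt am (dn x) x) ∧
      (∀ x, sn x = Real.sin (am x)) ∧ ∀ x, cn x = Real.cos (am x) := by
  set am : ℝ → ℝ := fun x => ∫ t in (0:ℝ)..x, dn t
  have h_zero : am 0 = 0 := intervalIntegral.integral_same
  have h_deriv (x : ℝ) : HasDerivAt am (dn x) x :=
    (hJ.continuous_dn.integral_hasStrictDerivAt 0 x).hasDerivAt
  have h_sin (x : ℝ) : sn x * Real.cos (am x) - cn x * Real.sin (am x) = 0 := by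
    have h := eq_of_forall_hasDerivAt_zero
      (f := fun x => sn x * Real.cos (am x) - cn x * Real.sin (am x)) (fun x => by
        refine (((hJ.hasDerivAt_sn x).fun_mul (h_deriv x).cos).fun_sub
          ((hJ.hasDerivAt_cn x).fun_mul (h_deriv x).sin)).congr_deriv ?_
        ring) x 0
    simpa [h_zero, hJ.sn_zero] using h
  have h_cos (x : ℝ) : cn x * Real.cos (am x) + sn x * Real.sin (am x) = 1 := by
    have h := eq_of_forall_hasDerivAt_zero
      (f := fun x => cn x * Real.cos (am x) + sn x * Real.sin (am x)) (fun x => by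
        refine (((hJ.hasDerivAt_cn x).fun_mul (h_deriv x).cos).fun_add
          ((hJ.hasDerivAt_sn x).fun_mul (h_deriv x).sin)).congr_deriv ?_
        ring) x 0
    simpa [h_zero, hJ.cn_zero] using h
  refine ⟨am, h_zero, h_deriv, fun x => ?_, fun x => ?_⟩
  · linear_combination Real.cos (am x) * h_sin x + Real.sin (am x) * h_cos x -
      sn x * Real.sin_sq_add_cos_sq (am x)
  · linear_combination Real.cos (am x) * h_cos x - Real.sin (am x) * h_sin x -
      cn x * Real.sin_sq_add_cos_sq (am x)

end IsJacobiSystem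

/-- Values of the Jacobi elliptic functions at the quarter period `K(p)`:
`sn(K) = 1`, `cn(K) = 0`, `dn(K) = √(1−p²)`. -/
theorem jacobi_at_quarter_period (p : ℝ) (hp0 : 0 ≤ p) (hp1 : p < 1)
    (sn cn dn : ℝ → ℝ) (hJ : IsJacobiSystem p sn cn dn) :
    sn (ellipticK p) = 1 ∧ cn (ellipticK p) = 0 ∧
      dn (ellipticK p) = Real.sqrt (1 - p ^ 2) := by
  have hp : p ^ 2 < 1 := by nlinarith
  obtain ⟨am, h_zero, h_deriv, h_sn, h_cn⟩ := hJ.exists_amplitude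
  have h_inv (x : ℝ) : ellipticF p (am x) = x := by
    have h := eq_of_forall_hasDerivAt_zero (f := fun x => ellipticF p (am x) - x) (fun x => by
      refine (((hasDerivAt_ellipticF hp (am x)).comp x (h_deriv x)).fun_sub
        (hasDerivAt_id' x)).congr_deriv ?_
      rw [← h_sn, ← hJ.dn_eq_sqrt hp, one_div_mul_cancel (hJ.dn_pos hp x).ne', sub_self]) x 0
    simp only [h_zero, ellipticF, intervalIntegral.integral_same, sub_zero] at h
    exact sub_eq_zero.1 h
  have h_am : am (ellipticK p) = Real.pi / 2 :=
    (strictMono_ellipticF hp).injective (h_inv (ellipticK p))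
  have h_one : sn (ellipticK p) = 1 := by rw [h_sn, h_am, Real.sin_pi_div_two]
  refine ⟨h_one, by rw [h_cn, h_am, Real.cos_pi_div_two], ?_⟩
  rw [hJ.dn_eq_sqrt hp, h_one, one_pow, mul_one]
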